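/- Let a₁, a₂, a₃ and b₁, b₂, b₃ be the vertices of two triangles in the plane ℝ², and suppose the 6 vertices are in general position: they are pairwise distinct, no three of them are collinear, and no three of the segments joining pairs of the six points have a common interior point. Let ∂A = segment ℝ a₁ a₂ ∪ segment ℝ a₂ a₃ ∪ segment ℝ a₃ a₁ and ∂B = segment ℝ b₁ b₂ ∪ segment ℝ b₂ b₃ ∪ segment ℝ b₃ b₁ be the boundaries of the two triangles. Then the intersection ∂A ∩ ∂B is a finite set of even cardinality. -/

import Mathlib

/-- Twice the signed area of the triangle `p q r`. -/
def orient (p q r : EuclideanSpace ℝ (Fin 2)) : ℝ :=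
  (q 0 - p 0) * (r 1 - p 1) - (q 1 - p 1) * (r 0 - p 0)

theorem orient_rotate (p q r : EuclideanSpace ℝ (Fin 2)) : orient q r p = orient p q r := by
  unfold orient; ring

theorem collinear_of_orient_eq_zero {p q r : EuclideanSpace ℝ (Fin 2)} (h : orient p q r = 0) :
    Collinear ℝ {p, q, r} := by
  by_cases hpq : q = p
  · subst hpq
    simpa using collinear_pair ℝ q r
  rw [collinear_iff_of_mem (p₀ := p) (by simp)]
  refine ⟨q - p, ?_⟩
  have hr : ∃ c : ℝ, r = c • (q - p) + p := by
    unfold orient at h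
    by_cases h0 : q 0 - p 0 = 0
    · have h1 : q 1 - p 1 ≠ 0 := by
        intro h1
        apply hpq
        ext i
        fin_cases i
        · exact sub_eq_zero.mp h0
        · exact sub_eq_zero.mp h1
      refine ⟨(r 1 - p 1) / (q 1 - p 1), ?_⟩
      ext i
      fin_cases i <;> simp <;> field_simp <;> linarith
    · refine ⟨(r 0 - p 0) / (q 0 - p 0), ?_⟩
      ext i
      fin_cases i <;> simp <;> field_simp <;> linarith
  intro x hx
  simp only [Set.mem_insert_iff, Set.mem_singleton_iff] at hx
  rcases hx with rfl | rfl | rfl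
  · exact ⟨0, by simp⟩
  · exact ⟨1, by simp⟩
  · simpa using hr

theorem orient_combo (p q r s : EuclideanSpace ℝ (Fin 2)) {α β : ℝ} (h : α + β = 1) :
    orient (α • p + β • q) r s = α * orient p r s + β * orient q r s := by
  obtain rfl : α = 1 - β := by linarith
  simp [orient]
  ring

theorem orient_eq_zero_of_mem_segment {x p q : EuclideanSpace ℝ (Fin 2)}
    (h : x ∈ segment ℝ p q) : orient x p q = 0 := by
  obtain ⟨α, β, -, -, hab, rfl⟩ := h
  rw [orient_combo _ _ _ _ hab]
  simp [orient]

/-- The sign condition for the segments `p q` and `r s` to cross. -/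
def Crosses (p q r s : EuclideanSpace ℝ (Fin 2)) : Prop :=
  orient p r s * orient q r s < 0 ∧ orient r p q * orient s p q < 0

theorem segment_inter_subsingleton {p q r s : EuclideanSpace ℝ (Fin 2)}
    (hp : orient p r s ≠ 0) :
    (segment ℝ p q ∩ segment ℝ r s).Subsingleton := by
  rintro x ⟨⟨α, β, -, -, hab, rfl⟩, hx⟩ y ⟨⟨γ, δ, -, -, hcd, rfl⟩, hy⟩
  have h1 := orient_eq_zero_of_mem_segment hx
  have h2 := orient_eq_zero_of_mem_segment hy
  rw [orient_combo _ _ _ _ hab] at h1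
  rw [orient_combo _ _ _ _ hcd] at h2
  obtain rfl : α = 1 - β := by linarith
  obtain rfl : γ = 1 - δ := by linarith
  have h3 : (β - δ) * orient p r s = 0 := by linear_combination β * h2 - δ * h1
  obtain rfl : β = δ := by
    rcases mul_eq_zero.mp h3 with h | h
    · linarith
    · exact absurd h hp
  rfl

theorem mul_neg_of_combo_eq_zero {α β A B : ℝ} (hα : 0 ≤ α) (hβ : 0 ≤ β) (hab : α + β = 1)
    (hA : A ≠ 0) (hB : B ≠ 0) (h : α * A + β * B = 0) : A * B < 0 := by
  rcases lt_or_gt_of_ne hA with hA | hA <;> rcases lt_or_gt_of_ne hB with hB | hB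
  · exact absurd h ((convex_Iio (0 : ℝ)) hA hB hα hβ hab).ne
  · exact mul_neg_of_neg_of_pos hA hB
  · exact mul_neg_of_pos_of_neg hA hB
  · exact absurd h ((convex_Ioi (0 : ℝ)) hA hB hα hβ hab).ne'

theorem segment_inter_nonempty_iff {p q r s : EuclideanSpace ℝ (Fin 2)}
    (hp : orient p r s ≠ 0) (hq : orient q r s ≠ 0)
    (hr : orient r p q ≠ 0) (hs : orient s p q ≠ 0) :
    (segment ℝ p q ∩ segment ℝ r s).Nonempty ↔ Crosses p q r s := by
  constructor
  · rintro ⟨x, hx, hy⟩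
    have h1 := orient_eq_zero_of_mem_segment hx
    have h2 := orient_eq_zero_of_mem_segment hy
    obtain ⟨α, β, hα, hβ, hab, rfl⟩ := hx
    obtain ⟨γ, δ, hγ, hδ, hcd, hxy⟩ := hy
    rw [← hxy, orient_combo _ _ _ _ hcd] at h1
    rw [orient_combo _ _ _ _ hab] at h2
    exact ⟨mul_neg_of_combo_eq_zero hα hβ hab hp hq h2,
      mul_neg_of_combo_eq_zero hγ hδ hcd hr hs h1⟩
  · rintro ⟨h1, h2⟩
    have key : ∀ A B : ℝ, A * B < 0 → 0 ≤ -B / (A - B) ∧ 0 ≤ A / (A - B) ∧ A - B ≠ 0 := by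
      intro A B h
      rcases mul_neg_iff.mp h with ⟨hA, hB⟩ | ⟨hA, hB⟩
      · exact ⟨div_nonneg (by linarith) (by linarith), div_nonneg (by linarith) (by linarith),
          by linarith⟩
      · exact ⟨div_nonneg_of_nonpos (by linarith) (by linarith),
          div_nonneg_of_nonpos (by linarith) (by linarith), by linarith⟩
    obtain ⟨a1, a2, a3⟩ := key _ _ h1
    obtain ⟨b1, b2, b3⟩ := key _ _ h2
    refine ⟨_, ⟨_, _, a1, a2, by field_simp; ring, rfl⟩, ⟨_, _, b1, b2, by field_simp; ring, ?_⟩⟩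
    have hAB : orient r p q - orient s p q = -(orient p r s - orient q r s) := by
      unfold orient; ring
    rw [hAB]
    generalize orient p r s - orient q r s = d at a3
    ext i
    fin_cases i <;> simp <;> field_simp <;> unfold orient <;> ring

/-- The sign condition for `p` to lie inside the triangle `b`. -/
def Inside (b : Fin 3 → EuclideanSpace ℝ (Fin 2)) (p : EuclideanSpace ℝ (Fin 2)) : Prop :=
  ((0 < orient p (b 0) (b 1)) ↔ (0 < orient p (b 1) (b 2))) ∧
  ((0 < orient p (b 1) (b 2)) ↔ (0 < orient p (b 2) (b 0)))

theorem mul_neg_iff_not_iff {x y : ℝ} (hx : x ≠ 0) (hy : y ≠ 0) :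
    x * y < 0 ↔ ¬ (0 < x ↔ 0 < y) := by
  rw [mul_neg_iff]
  grind

theorem sign_of_mul_eq_sub {d u s t s' t' : ℝ} (hd : d ≠ 0) (hu : u ≠ 0)
    (hs : s ≠ 0) (ht : t ≠ 0) (hs' : s' ≠ 0) (ht' : t' ≠ 0) (h : d * u = s * t' - s' * t) :
    ((0 < s ↔ 0 < t') → ¬ (0 < s' ↔ 0 < t) → (0 < d ↔ 0 < u)) ∧
    (¬ (0 < s ↔ 0 < t') → (0 < s' ↔ 0 < t) → ¬ (0 < d ↔ 0 < u)) := by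
  have h₁ := mul_neg_iff_not_iff hs ht'
  have h₂ := mul_neg_iff_not_iff hs' ht
  have h₃ := mul_neg_iff_not_iff hd hu
  have h₄ := mul_ne_zero hs ht'
  have h₅ := mul_ne_zero hs' ht
  rw [h] at h₃
  generalize s * t' = x at *
  generalize s' * t = y at *
  grind

set_option synthInstance.maxSize 2000 in
set_option synthInstance.maxHeartbeats 400000 in
set_option maxRecDepth 100000 in
theorem sign_parity (D s₀ s₁ s₂ t₀ t₁ t₂ u₀ u₁ u₂ : Bool)
    (hs : s₀ = s₁ → s₁ = s₂ → s₂ = D) (ht : t₀ = t₁ → t₁ = t₂ → t₂ = D)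
    (h₀ : ((s₂ = t₀) → ¬ (s₀ = t₂) → (D = u₀)) ∧ (¬ (s₂ = t₀) → (s₀ = t₂) → ¬ (D = u₀)))
    (h₁ : ((s₀ = t₁) → ¬ (s₁ = t₀) → (D = u₁)) ∧ (¬ (s₀ = t₁) → (s₁ = t₀) → ¬ (D = u₁)))
    (h₂ : ((s₁ = t₂) → ¬ (s₂ = t₁) → (D = u₂)) ∧ (¬ (s₁ = t₂) → (s₂ = t₁) → ¬ (D = u₂))) :
    ((if ¬ (s₀ = t₀) ∧ ¬ (u₀ = u₁) then 1 else 0) + (if ¬ (s₁ = t₁) ∧ ¬ (u₁ = u₂) then 1 else 0) +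
      (if ¬ (s₂ = t₂) ∧ ¬ (u₂ = u₀) then 1 else 0) : ZMod 2) =
    (if s₀ = s₁ ∧ s₁ = s₂ then 1 else 0) + (if t₀ = t₁ ∧ t₁ = t₂ then 1 else 0) := by
  revert D s₀ s₁ s₂ t₀ t₁ t₂ u₀ u₁ u₂
  decide

open Classical in
theorem sum_crosses (b : Fin 3 → EuclideanSpace ℝ (Fin 2)) (p q : EuclideanSpace ℝ (Fin 2))
    (hb : orient (b 0) (b 1) (b 2) ≠ 0) (hp : ∀ j, orient p (b j) (b (j + 1)) ≠ 0)
    (hq : ∀ j, orient q (b j) (b (j + 1)) ≠ 0) (hu : ∀ j, orient (b j) p q ≠ 0) :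
    (∑ j, if Crosses p q (b j) (b (j + 1)) then 1 else 0 : ZMod 2) =
      (if Inside b p then 1 else 0) + (if Inside b q then 1 else 0) := by
  have e2 : (2 : Fin 3) + 1 = 0 := rfl
  have e1 : (1 : Fin 3) + 1 = 2 := rfl
  have p0 := hp 0
  have p1 := hp 1
  have p2 := hp 2
  have q0 := hq 0
  have q1 := hq 1
  have q2 := hq 2
  simp only [zero_add, e1, e2] at p0 p1 p2 q0 q1 q2
  have hsum : ∀ x, orient x (b 0) (b 1) + orient x (b 1) (b 2) + orient x (b 2) (b 0) =
      orient (b 0) (b 1) (b 2) := by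
    intro x; unfold orient; ring
  have hall : ∀ x, orient x (b 0) (b 1) ≠ 0 → orient x (b 1) (b 2) ≠ 0 →
      orient x (b 2) (b 0) ≠ 0 →
      (0 < orient x (b 0) (b 1) ↔ 0 < orient x (b 1) (b 2)) →
      (0 < orient x (b 1) (b 2) ↔ 0 < orient x (b 2) (b 0)) →
      (0 < orient x (b 2) (b 0) ↔ 0 < orient (b 0) (b 1) (b 2)) := by
    intro x
    have := hsum x
    grind
  have key := sign_parity (decide (0 < orient (b 0) (b 1) (b 2)))
    (decide (0 < orient p (b 0) (b 1))) (decide (0 < orient p (b 1) (b 2)))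
    (decide (0 < orient p (b 2) (b 0)))
    (decide (0 < orient q (b 0) (b 1))) (decide (0 < orient q (b 1) (b 2)))
    (decide (0 < orient q (b 2) (b 0)))
    (decide (0 < orient (b 0) p q)) (decide (0 < orient (b 1) p q)) (decide (0 < orient (b 2) p q))
  simp only [decide_eq_decide] at key
  simp only [Fin.sum_univ_three, zero_add, e1, e2, Crosses, Inside,
    mul_neg_iff_not_iff p0 q0, mul_neg_iff_not_iff p1 q1, mul_neg_iff_not_iff p2 q2,
    mul_neg_iff_not_iff (hu 0) (hu 1), mul_neg_iff_not_iff (hu 1) (hu 2),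
    mul_neg_iff_not_iff (hu 2) (hu 0)]
  convert key (hall p p0 p1 p2) (hall q q0 q1 q2)
    (sign_of_mul_eq_sub hb (hu 0) p2 q2 p0 q0 (by unfold orient; ring))
    (sign_of_mul_eq_sub hb (hu 1) p0 q0 p1 q1 (by unfold orient; ring))
    (sign_of_mul_eq_sub hb (hu 2) p1 q1 p2 q2 (by unfold orient; ring)) <;> congr

/-- Distinct sides of a triangle meet only in vertices. -/
theorem exists_eq_vertex_of_mem_sides {a : Fin 3 → EuclideanSpace ℝ (Fin 2)}
    (ha : orient (a 0) (a 1) (a 2) ≠ 0) {i j : Fin 3} (hij : i ≠ j)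
    {x : EuclideanSpace ℝ (Fin 2)} (hi : x ∈ segment ℝ (a i) (a (i + 1)))
    (hj : x ∈ segment ℝ (a j) (a (j + 1))) : ∃ k, x = a k := by
  have key : ∀ i : Fin 3, x ∈ segment ℝ (a i) (a (i + 1)) →
      x ∈ segment ℝ (a (i + 1)) (a (i + 1 + 1)) → x = a (i + 1) := by
    intro i h1 h2
    have hne : orient (a i) (a (i + 1)) (a (i + 1 + 1)) ≠ 0 := by
      fin_cases i
      · exact ha
      · change orient (a 1) (a 2) (a 0) ≠ 0
        rwa [orient_rotate]
      · change orient (a 2) (a 0) (a 1) ≠ 0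
        rwa [← orient_rotate]
    exact segment_inter_subsingleton hne ⟨h1, h2⟩
      ⟨right_mem_segment _ _ _, left_mem_segment _ _ _⟩
  have hcase : j = i + 1 ∨ i = j + 1 := by clear hi hj; revert i j; decide
  rcases hcase with rfl | rfl
  · exact ⟨_, key _ hi hj⟩
  · exact ⟨_, key _ hj hi⟩

open Classical in
theorem even_card_crosses (a b : Fin 3 → EuclideanSpace ℝ (Fin 2))
    (hb : orient (b 0) (b 1) (b 2) ≠ 0)
    (hab : ∀ i j, orient (a i) (b j) (b (j + 1)) ≠ 0)
    (hba : ∀ i j, orient (b j) (a i) (a (i + 1)) ≠ 0) :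
    Even (Finset.univ.filter fun ij : Fin 3 × Fin 3 =>
      Crosses (a ij.1) (a (ij.1 + 1)) (b ij.2) (b (ij.2 + 1))).card := by
  rw [← ZMod.natCast_eq_zero_iff_even, Finset.card_filter, Nat.cast_sum, Fintype.sum_prod_type]
  push_cast
  simp only [sum_crosses b _ _ hb (hab _) (hab _) (hba _)]
  have hshift := Equiv.sum_comp (Equiv.addRight (1 : Fin 3))
    fun i => if Inside b (a i) then (1 : ZMod 2) else 0
  rw [Finset.sum_add_distrib]
  exact (congrArg _ hshift).trans (CharTwo.add_self_eq_zero _)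

theorem sides_eq_iUnion (a : Fin 3 → EuclideanSpace ℝ (Fin 2)) :
    segment ℝ (a 0) (a 1) ∪ segment ℝ (a 1) (a 2) ∪ segment ℝ (a 2) (a 0) =
      ⋃ i, segment ℝ (a i) (a (i + 1)) := by
  ext x
  simp only [Set.mem_union, Set.mem_iUnion, Fin.exists_fin_succ, Fin.exists_fin_zero]
  simp [or_assoc]


/-- Parity Lemma: if the 6 vertices of two triangles in the plane are in general
position, then the boundaries of the triangles intersect in a finite set of even
cardinality. -/
theorem stmt_7 (a b : Fin 3 → EuclideanSpace ℝ (Fin 2))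
    (hinj : Function.Injective (Sum.elim a b : Fin 3 ⊕ Fin 3 → EuclideanSpace ℝ (Fin 2)))
    (hcol : ∀ i j k : Fin 3 ⊕ Fin 3, i ≠ j → i ≠ k → j ≠ k →
      ¬ Collinear ℝ ({Sum.elim a b i, Sum.elim a b j, Sum.elim a b k} :
        Set (EuclideanSpace ℝ (Fin 2))))
    (hgen : ∀ i₁ j₁ i₂ j₂ i₃ j₃ : Fin 3 ⊕ Fin 3, i₁ ≠ j₁ → i₂ ≠ j₂ → i₃ ≠ j₃ →
      ({i₁, j₁} : Finset (Fin 3 ⊕ Fin 3)) ≠ ({i₂, j₂} : Finset (Fin 3 ⊕ Fin 3)) →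
      ({i₁, j₁} : Finset (Fin 3 ⊕ Fin 3)) ≠ ({i₃, j₃} : Finset (Fin 3 ⊕ Fin 3)) →
      ({i₂, j₂} : Finset (Fin 3 ⊕ Fin 3)) ≠ ({i₃, j₃} : Finset (Fin 3 ⊕ Fin 3)) →
      openSegment ℝ (Sum.elim a b i₁) (Sum.elim a b j₁) ∩
        openSegment ℝ (Sum.elim a b i₂) (Sum.elim a b j₂) ∩
        openSegment ℝ (Sum.elim a b i₃) (Sum.elim a b j₃) = ∅) :
    ((segment ℝ (a 0) (a 1) ∪ segment ℝ (a 1) (a 2) ∪ segment ℝ (a 2) (a 0)) ∩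
      (segment ℝ (b 0) (b 1) ∪ segment ℝ (b 1) (b 2) ∪ segment ℝ (b 2) (b 0))).Finite ∧
    Even (((segment ℝ (a 0) (a 1) ∪ segment ℝ (a 1) (a 2) ∪ segment ℝ (a 2) (a 0)) ∩
      (segment ℝ (b 0) (b 1) ∪ segment ℝ (b 1) (b 2) ∪ segment ℝ (b 2) (b 0))).ncard) := by
  classical
  have hor : ∀ i j k : Fin 3 ⊕ Fin 3, i ≠ j → i ≠ k → j ≠ k →
      orient (Sum.elim a b i) (Sum.elim a b j) (Sum.elim a b k) ≠ 0 :=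
    fun i j k h1 h2 h3 h => hcol i j k h1 h2 h3 (collinear_of_orient_eq_zero h)
  have ha : orient (a 0) (a 1) (a 2) ≠ 0 :=
    hor (.inl 0) (.inl 1) (.inl 2) (by decide) (by decide) (by decide)
  have hb : orient (b 0) (b 1) (b 2) ≠ 0 :=
    hor (.inr 0) (.inr 1) (.inr 2) (by decide) (by decide) (by decide)
  have hab : ∀ i j, orient (a i) (b j) (b (j + 1)) ≠ 0 := fun i j =>
    hor (.inl i) (.inr j) (.inr (j + 1)) (by simp) (by simp) (by simp)
  have hba : ∀ i j, orient (b j) (a i) (a (i + 1)) ≠ 0 := fun i j =>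
    hor (.inr j) (.inl i) (.inl (i + 1)) (by simp) (by simp) (by simp)
  let S := Finset.univ.filter fun ij : Fin 3 × Fin 3 =>
    Crosses (a ij.1) (a (ij.1 + 1)) (b ij.2) (b (ij.2 + 1))
  have hex : ∀ ij ∈ S, (segment ℝ (a ij.1) (a (ij.1 + 1)) ∩
      segment ℝ (b ij.2) (b (ij.2 + 1))).Nonempty := fun ij h =>
    (segment_inter_nonempty_iff (hab _ _) (hab _ _) (hba _ _) (hba _ _)).mpr
      (Finset.mem_filter.mp h).2
  choose! f hf using hex
  have hinjOn : Set.InjOn f S := by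
    intro x hx y hy hxy
    obtain ⟨hx1, hx2⟩ := hf x hx
    obtain ⟨hy1, hy2⟩ := hf y hy
    rw [← hxy] at hy1 hy2
    by_contra hne
    rcases not_and_or.mp (mt Prod.ext_iff.mpr hne) with h | h
    · obtain ⟨k, hk⟩ := exists_eq_vertex_of_mem_sides ha h hx1 hy1
      exact hab k _ (hk ▸ orient_eq_zero_of_mem_segment hx2)
    · obtain ⟨k, hk⟩ := exists_eq_vertex_of_mem_sides hb h hx2 hy2
      exact hba _ k (hk ▸ orient_eq_zero_of_mem_segment hx1)
  have himage : (⋃ i, segment ℝ (a i) (a (i + 1))) ∩ (⋃ j, segment ℝ (b j) (b (j + 1))) =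
      ↑(S.image f) := by
    ext x
    simp only [Set.mem_inter_iff, Set.mem_iUnion, Finset.coe_image, Set.mem_image,
      Finset.mem_coe]
    constructor
    · rintro ⟨⟨i, hi⟩, j, hj⟩
      have hS : (i, j) ∈ S := Finset.mem_filter.mpr ⟨Finset.mem_univ _,
        (segment_inter_nonempty_iff (hab _ _) (hab _ _) (hba _ _) (hba _ _)).mp ⟨x, hi, hj⟩⟩
      exact ⟨(i, j), hS, segment_inter_subsingleton (hab _ _) (hf _ hS) ⟨hi, hj⟩⟩
    · rintro ⟨ij, h, rfl⟩
      exact ⟨⟨_, (hf _ h).1⟩, _, (hf _ h).2⟩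
  rw [sides_eq_iUnion a, sides_eq_iUnion b, himage]
  refine ⟨Finset.finite_toSet _, ?_⟩
  rw [Set.ncard_coe_finset, Finset.card_image_of_injOn hinjOn]
  exact even_card_crosses a b hb hab hba
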